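/- For each positive integer n, the matrix algebra (M_n(𝔽), 𝔽, +_𝔽, |·|) is not an e⃗-Ramsey algebra for any nonconstant e⃗ ∈ Ω_0. -/

import Mathlib

universe u v

/-- A (heterogeneous) operation: a list of input sorts, an output sort, and an
underlying function on lists of elements (only its values on lists of the right
length and sorts matter). -/
structure HetOp (I : Type u) (U : Type v) where
  inSorts : List I
  outSort : I
  fn : List U → U

namespace HetRamsey

variable {I : Type u} {U : Type v}

/-- `f` maps the phyla prescribed by its input sorts into the phylum of its output sort. -/
def WellSorted (A : I → Set U) (f : HetOp I U) : Prop :=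
  ∀ xs : List U, List.Forall₂ (fun x ξ => x ∈ A ξ) xs f.inSorts → f.fn xs ∈ A f.outSort

/-- Apply the operations in `hs` to consecutive chunks of the list `xs`. -/
def applyChunks : List (HetOp I U) → List U → List U
  | [], _ => []
  | h :: t, xs => h.fn (xs.take h.inSorts.length) :: applyChunks t (xs.drop h.inSorts.length)

/-- The orderly terms over a family `F` of operations: `F` itself, the identity
operations, closed under orderly composition. -/
inductive OT (F : Set (HetOp I U)) : HetOp I U → Prop
  | base {f : HetOp I U} : f ∈ F → OT F f
  | id (ξ : I) (c : HetOp I U) :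
      c.inSorts = [ξ] → c.outSort = ξ → (∀ x : U, c.fn [x] = x) → OT F c
  | comp (g : HetOp I U) (hs : List (HetOp I U)) :
      g ∈ F → (∀ h ∈ hs, OT F h) →
      List.Forall₂ (fun (h : HetOp I U) ξ => h.outSort = ξ) hs g.inSorts →
      OT F ⟨(hs.map HetOp.inSorts).flatten, g.outSort, fun xs => g.fn (applyChunks hs xs)⟩

/-- `b` is `e`-sorted: the `i`-th term lies in phylum `A (e i)`. -/
def Sorted (A : I → Set U) (e : ℕ → I) (b : ℕ → U) : Prop :=
  ∀ i, b i ∈ A (e i)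

/-- `a` is a reduction of `b` with respect to the family of operations `F`:
each term `a j` is obtained by applying an orderly term over `F` to a finite
subsequence of `b`, and these finite subsequences concatenate to a
subsequence of `b`. -/
def Reduction (A : I → Set U) (F : Set (HetOp I U)) (a b : ℕ → U) : Prop :=
  ∃ (φ : ℕ → List ℕ) (f : ℕ → HetOp I U),
    (∀ j, OT F (f j)) ∧
    (∀ j, (φ j).Chain' (· < ·)) ∧
    (∀ j k, j < k → ∀ x ∈ φ j, ∀ y ∈ φ k, x < y) ∧
    (∀ j, List.Forall₂ (fun i ξ => b i ∈ A ξ) (φ j) (f j).inSorts) ∧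
    (∀ j, a j = (f j).fn ((φ j).map b))

/-- `FR^e_F(b)`: the set of first terms of `e`-sorted reductions of `b`. -/
def FR (A : I → Set U) (F : Set (HetOp I U)) (e : ℕ → I) (b : ℕ → U) : Set U :=
  { x | ∃ a : ℕ → U, Reduction A F a b ∧ Sorted A e a ∧ a 0 = x }

/-- The algebra with phyla `A` and operations `F` is an `e`-Ramsey algebra. -/
def IsERamsey (A : I → Set U) (F : Set (HetOp I U)) (e : ℕ → I) : Prop :=
  ∀ b : ℕ → U, Sorted A e b → ∀ X : Set U, X ⊆ A (e 0) →
    ∃ a : ℕ → U, Reduction A F a b ∧ Sorted A e a ∧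
      (FR A F e a ⊆ X ∨ FR A F e a ∩ X = ∅)

/-- The homogeneous algebra `(A ξ, F)` is a Ramsey algebra: it is `e`-Ramsey for
the constant sort with value `ξ`. -/
def IsRamsey (A : I → Set U) (F : Set (HetOp I U)) (ξ : I) : Prop :=
  IsERamsey A F fun _ => ξ

/-- For a homogeneous algebra: `FR_G(α) = { f(τ) : f ∈ OT(G), τ a finite subsequence of α }`. -/
def FRfin (A : I → Set U) (G : Set (HetOp I U)) (α : ℕ → U) : Set U :=
  { x | ∃ (f : HetOp I U) (ns : List ℕ), OT G f ∧ ns.Chain' (· < ·) ∧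
      List.Forall₂ (fun i ξ => α i ∈ A ξ) ns f.inSorts ∧ x = f.fn (ns.map α) }

/-- `e ∈ Ω`: every value attained by the sort `e` is attained infinitely often. -/
def InOmega (e : ℕ → I) : Prop :=
  ∀ i, {j | e j = e i}.Infinite

end HetRamsey
namespace HetRamsey

/-- The underlying universe of a matrix algebra: scalars (left) and matrices (right). -/
abbrev MatU (𝔽 : Type) (n : ℕ) : Type := 𝔽 ⊕ Matrix (Fin n) (Fin n) 𝔽

/-- The two phyla: index `0` is the scalar phylum `𝔽`, index `1` the matrix phylum. -/
def matPhyla (𝔽 : Type) (n : ℕ) : Fin 2 → Set (MatU 𝔽 n) :=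
  fun i => if i = 0 then Set.range Sum.inl else Set.range Sum.inr

def toScal {𝔽 : Type} [Zero 𝔽] {n : ℕ} : MatU 𝔽 n → 𝔽
  | Sum.inl r => r
  | Sum.inr _ => 0

def toMat {𝔽 : Type} [Zero 𝔽] {n : ℕ} : MatU 𝔽 n → Matrix (Fin n) (Fin n) 𝔽
  | Sum.inl _ => 0
  | Sum.inr m => m

/-- Matrix addition as a heterogeneous operation. -/
def matAddOp (𝔽 : Type) [Field 𝔽] (n : ℕ) : HetOp (Fin 2) (MatU 𝔽 n) :=
  ⟨[1, 1], 1, fun xs => match xs with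
    | [x, y] => Sum.inr (toMat x + toMat y)
    | _ => Sum.inl 0⟩

/-- Matrix multiplication as a heterogeneous operation. -/
def matMulOp (𝔽 : Type) [Field 𝔽] (n : ℕ) : HetOp (Fin 2) (MatU 𝔽 n) :=
  ⟨[1, 1], 1, fun xs => match xs with
    | [x, y] => Sum.inr (toMat x * toMat y)
    | _ => Sum.inl 0⟩

/-- Field addition as a heterogeneous operation. -/
def scalAddOp (𝔽 : Type) [Field 𝔽] (n : ℕ) : HetOp (Fin 2) (MatU 𝔽 n) :=
  ⟨[0, 0], 0, fun xs => match xs with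
    | [x, y] => Sum.inl (toScal x + toScal y)
    | _ => Sum.inl 0⟩

/-- Field multiplication as a heterogeneous operation. -/
def scalMulOp (𝔽 : Type) [Field 𝔽] (n : ℕ) : HetOp (Fin 2) (MatU 𝔽 n) :=
  ⟨[0, 0], 0, fun xs => match xs with
    | [x, y] => Sum.inl (toScal x * toScal y)
    | _ => Sum.inl 0⟩

/-- The determinant as a heterogeneous operation from the matrix phylum to the scalar phylum. -/
def detOp (𝔽 : Type) [Field 𝔽] (n : ℕ) : HetOp (Fin 2) (MatU 𝔽 n) :=
  ⟨[1], 0, fun xs => match xs with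
    | [x] => Sum.inl (toMat x).det
    | _ => Sum.inl 0⟩

end HetRamsey

open HetRamsey

namespace HetRamsey

/-- A reduction sorted by `e ∈ Ω` can start with the value of any orderly term of the right sort:
the later terms can be taken from the tail of the sequence. -/
theorem mem_FR_of_OT {I : Type*} {U : Type*} {A : I → Set U} {F : Set (HetOp I U)} {e : ℕ → I}
    (he : InOmega e) {a : ℕ → U} (ha : Sorted A e a) {f : HetOp I U} (hf : OT F f)
    {l : List ℕ} (hl : l.IsChain (· < ·))
    (hs : List.Forall₂ (fun i ξ => a i ∈ A ξ) l f.inSorts)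
    (h0 : f.fn (l.map a) ∈ A (e 0)) : f.fn (l.map a) ∈ FR A F e a := by
  have hnext : ∀ k m, ∃ i, m < i ∧ e i = e k := fun k m => by
    obtain ⟨i, hi, hmi⟩ := (he k).exists_gt m
    exact ⟨i, hmi, hi⟩
  choose g hg hge using hnext
  let ψ : ℕ → ℕ := fun k => Nat.rec (g 0 l.sum) (fun k p => g (k + 1) p) k
  have hψ : StrictMono ψ := strictMono_nat_of_lt_succ fun k => hg (k + 1) (ψ k)
  have hψe : ∀ k, e (ψ k) = e k := by
    rintro (_ | k)
    · exact hge 0 _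
    · exact hge (k + 1) _
  have hψl : ∀ k, ∀ x ∈ l, x < ψ k := fun k x hx =>
    ((List.single_le_sum (by simp) x hx).trans_lt (hg 0 l.sum)).trans_le
      (hψ.monotone (Nat.zero_le k))
  let idOp : I → HetOp I U := fun ξ => ⟨[ξ], ξ, fun xs => xs.headD (a 0)⟩
  refine ⟨fun k => if k = 0 then f.fn (l.map a) else a (ψ k),
    ⟨fun k => if k = 0 then l else [ψ k], fun k => if k = 0 then f else idOp (e k),
      ?_, ?_, ?_, ?_, ?_⟩, ?_, if_pos rfl⟩
  · intro k
    by_cases hk : k = 0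
    · simpa [hk] using hf
    · simpa [hk] using OT.id (F := F) (e k) (idOp (e k)) rfl rfl fun _ => rfl
  · intro k
    change List.IsChain (· < ·) _
    by_cases hk : k = 0 <;> simp [hk, hl]
  · intro j k hjk x hx y hy
    have hk : k ≠ 0 := by omega
    simp only [hk, if_false, List.mem_singleton] at hy
    subst hy
    by_cases hj : j = 0
    · simp only [hj, if_true] at hx
      exact hψl k x hx
    · simp only [hj, if_false, List.mem_singleton] at hx
      exact hx ▸ hψ hjk
  · intro k
    by_cases hk : k = 0
    · simpa [hk] using hs
    · simpa [hk, idOp, hψe] using ha (ψ k)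
  · intro k
    by_cases hk : k = 0 <;> simp [hk, idOp]
  · intro k
    by_cases hk : k = 0
    · simpa [hk] using h0
    · simpa [hk, hψe] using ha (ψ k)

theorem scalAddOp_fn_isLeft (𝔽 : Type) [Field 𝔽] (n : ℕ) (xs : List (MatU 𝔽 n)) :
    ((scalAddOp 𝔽 n).fn xs).isLeft := by
  simp only [scalAddOp]
  split <;> rfl

theorem detOp_fn_isLeft (𝔽 : Type) [Field 𝔽] (n : ℕ) (xs : List (MatU 𝔽 n)) :
    ((detOp 𝔽 n).fn xs).isLeft := by
  simp only [detOp]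
  split <;> rfl

/-- An orderly term over scalar addition and the determinant is scalar valued or an identity. -/
theorem OT.isLeft_or_id {𝔽 : Type} [Field 𝔽] {n : ℕ} {f : HetOp (Fin 2) (MatU 𝔽 n)}
    (hf : OT {scalAddOp 𝔽 n, detOp 𝔽 n} f) :
    (∀ xs, (f.fn xs).isLeft) ∨ ((∃ ξ, f.inSorts = [ξ]) ∧ ∀ x, f.fn [x] = x) := by
  have hF : ∀ g ∈ ({scalAddOp 𝔽 n, detOp 𝔽 n} : Set (HetOp (Fin 2) (MatU 𝔽 n))),
      ∀ xs, (g.fn xs).isLeft := by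
    rintro g (rfl | rfl) xs
    · exact scalAddOp_fn_isLeft 𝔽 n xs
    · exact detOp_fn_isLeft 𝔽 n xs
  cases hf with
  | base h => exact .inl (hF _ h)
  | id ξ _ h _ h' => exact .inr ⟨⟨ξ, h⟩, h'⟩
  | comp g hs hg _ _ => exact .inl fun xs => hF g hg _

/-- Scalar addition and the determinant create no new matrices. -/
theorem Reduction.exists_eq_of_eq_inr {𝔽 : Type} [Field 𝔽] {n : ℕ}
    {A : Fin 2 → Set (MatU 𝔽 n)} {a b : ℕ → MatU 𝔽 n}
    (h : Reduction A {scalAddOp 𝔽 n, detOp 𝔽 n} a b) {k : ℕ} {m : Matrix (Fin n) (Fin n) 𝔽}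
    (hk : a k = Sum.inr m) : ∃ i, b i = Sum.inr m := by
  obtain ⟨φ, f, hf, -, -, hs, hv⟩ := h
  rcases (hf k).isLeft_or_id with hl | ⟨⟨ξ, hξ⟩, hid⟩
  · have := hl ((φ k).map b)
    rw [← hv, hk] at this
    simp at this
  · have hlen := (hs k).length_eq
    rw [hξ] at hlen
    obtain ⟨i, hi⟩ := List.length_eq_one_iff.mp hlen
    exact ⟨i, by rw [← hk, hv, hi, List.map_singleton, hid]⟩

end HetRamsey

/-- for nonconstant `e ∈ Ω₀`, the matrix algebra
`(Mₙ(𝔽), 𝔽, +_𝔽, |·|)` is not an `e`-Ramsey algebra. -/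
theorem scalAdd_det_not_eRamsey
    (𝔽 : Type) [Field 𝔽] [CharZero 𝔽] (n : ℕ) (hn : 0 < n)
    (e : ℕ → Fin 2) (he : InOmega e) (he0 : e 0 = 0)
    (hnc : ∃ i j, e i ≠ e j) :
    ¬ IsERamsey (matPhyla 𝔽 n) {scalAddOp 𝔽 n, detOp 𝔽 n} e := by
  intro hR
  obtain ⟨p, hp⟩ : ∃ p, e p = 1 := by
    obtain ⟨i, j, hij⟩ := hnc
    by_contra! h
    have hi := h i
    have hj := h j
    omega
  let b : ℕ → MatU 𝔽 n := fun i => if e i = 0 then Sum.inl 0 else Sum.inr 1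
  have hb : Sorted (matPhyla 𝔽 n) e b := by
    intro i
    by_cases h : e i = 0 <;> simp [b, matPhyla, h]
  obtain ⟨a, hab, ha, hX⟩ := hR b hb {Sum.inl 1} (by simp [he0, matPhyla])
  have hone : ∀ k, e k = 1 → a k = Sum.inr 1 := by
    intro k hk
    obtain ⟨m, hm⟩ : a k ∈ Set.range Sum.inr := by simpa [hk, matPhyla] using ha k
    obtain ⟨i, hi⟩ := hab.exists_eq_of_eq_inr hm.symm
    by_cases h : e i = 0
    · simp [b, h] at hi
    · simpa [b, h, ← hm] using hi.symm
  obtain ⟨q, hq, hpq⟩ := (he p).exists_gt p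
  replace hq : e q = 1 := Eq.trans hq hp
  have hmem : (Sum.inr 1 : MatU 𝔽 n) ∈ matPhyla 𝔽 n 1 := ⟨1, rfl⟩
  have hdet : OT {scalAddOp 𝔽 n, detOp 𝔽 n} (detOp 𝔽 n) := .base (by simp)
  have h1 : Sum.inl 1 ∈ FR (matPhyla 𝔽 n) {scalAddOp 𝔽 n, detOp 𝔽 n} e a := by
    have := mem_FR_of_OT he ha hdet (l := [p]) (by simp)
      (by simpa [detOp, hone p hp] using hmem)
      (by simp [detOp, he0, matPhyla])
    simpa [detOp, toMat, hone p hp] using this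
  have h2 : Sum.inl (1 + 1) ∈ FR (matPhyla 𝔽 n) {scalAddOp 𝔽 n, detOp 𝔽 n} e a := by
    have hsum := OT.comp (F := {scalAddOp 𝔽 n, detOp 𝔽 n}) (scalAddOp 𝔽 n)
      [detOp 𝔽 n, detOp 𝔽 n] (by simp) (by simp [hdet]) (by simp [scalAddOp, detOp])
    have := mem_FR_of_OT he ha hsum (l := [p, q]) (by simpa using hpq)
      (by simpa [detOp, hone p hp, hone q hq] using hmem)
      (by simp [detOp, scalAddOp, applyChunks, he0, matPhyla])
    simpa [detOp, scalAddOp, applyChunks, toMat, toScal, hone p hp, hone q hq] using this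
  rcases hX with hX | hX
  · simpa using hX h2
  · exact hX.subset ⟨h1, rfl⟩
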